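/- Let K be an algebraically closed field of characteristic 0 and let F ∈ K[X,Y,Z] be a nonsingular homogeneous polynomial of degree 5. Then Aut(F) contains no subgroup isomorphic to the Klein four group ℤ/2 × ℤ/2. In particular, none of the groups ℤ/2 × ℤ/2, A₄, S₄, A₅ occurs as the automorphism group of a nonsingular plane curve of degree 5. -/

import Mathlib

open MvPolynomial Matrix

noncomputable section

variable {K : Type*} [Field K]

/-- The substitution `F ∘ A`, i.e. `X i ↦ ∑ j, A i j • X j`. -/
def substPoly (A : Matrix (Fin 3) (Fin 3) K) (F : MvPolynomial (Fin 3) K) :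
    MvPolynomial (Fin 3) K :=
  aeval (fun i => ∑ j, A i j • X j) F

lemma substPoly_one (F : MvPolynomial (Fin 3) K) : substPoly 1 F = F := by
  have h : (fun i => ∑ j, (1 : Matrix (Fin 3) (Fin 3) K) i j • X j)
      = (X : Fin 3 → MvPolynomial (Fin 3) K) := by
    funext i
    simp [Matrix.one_apply, ite_smul]
  rw [substPoly, h]
  exact aeval_X_left_apply F

lemma substPoly_smul (A : Matrix (Fin 3) (Fin 3) K) (c : K) (F : MvPolynomial (Fin 3) K) :
    substPoly A (c • F) = c • substPoly A F := by
  unfold substPoly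
  exact _root_.map_smul (aeval fun i => ∑ j, A i j • X j) c F

lemma substPoly_mul (A B : Matrix (Fin 3) (Fin 3) K) (F : MvPolynomial (Fin 3) K) :
    substPoly (A * B) F = substPoly B (substPoly A F) := by
  have hfun : (fun i => ∑ j, (A * B) i j • (X j : MvPolynomial (Fin 3) K))
      = fun i => (aeval fun i => (∑ j, B i j • X j : MvPolynomial (Fin 3) K))
          (∑ j, A i j • X j : MvPolynomial (Fin 3) K) := by
    funext i
    rw [map_sum]
    simp only [_root_.map_smul, aeval_X, Matrix.mul_apply, Finset.sum_smul, Finset.smul_sum, smul_smul]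
    exact Finset.sum_comm
  have h1 : substPoly (A * B) F
      = aeval (fun i => (aeval fun i => (∑ j, B i j • X j : MvPolynomial (Fin 3) K))
          (∑ j, A i j • X j : MvPolynomial (Fin 3) K)) F := by
    unfold substPoly
    exact congrArg
      (fun f => (aeval f : MvPolynomial (Fin 3) K →ₐ[K] MvPolynomial (Fin 3) K) F) hfun
  rw [h1, ← MvPolynomial.comp_aeval]
  rfl

/-- The subgroup of `GL₃(K)` preserving the polynomial `F` up to scalar. -/
def autGL (F : MvPolynomial (Fin 3) K) : Subgroup (GL (Fin 3) K) where
  carrier := {A | ∃ c : Kˣ, substPoly (A : Matrix (Fin 3) (Fin 3) K) F = (c : K) • F}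
  one_mem' := ⟨1, by simp [substPoly_one]⟩
  mul_mem' := by
    rintro A B ⟨c, hc⟩ ⟨e, he⟩
    refine ⟨c * e, ?_⟩
    have hAB : ((A * B : GL (Fin 3) K) : Matrix (Fin 3) (Fin 3) K)
        = (A : Matrix (Fin 3) (Fin 3) K) * (B : Matrix (Fin 3) (Fin 3) K) := rfl
    rw [hAB, substPoly_mul, hc, substPoly_smul, he, smul_smul, ← Units.val_mul]
  inv_mem' := by
    rintro A ⟨c, hc⟩
    refine ⟨c⁻¹, ?_⟩
    have key : (c : K) • substPoly ((A⁻¹ : GL (Fin 3) K) : Matrix (Fin 3) (Fin 3) K) F = F := by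
      rw [← substPoly_smul, ← hc, ← substPoly_mul]
      have h1 : (A : Matrix (Fin 3) (Fin 3) K) *
          ((A⁻¹ : GL (Fin 3) K) : Matrix (Fin 3) (Fin 3) K) = 1 := by
        exact_mod_cast Units.mul_inv A
      rw [h1, substPoly_one]
    calc substPoly ((A⁻¹ : GL (Fin 3) K) : Matrix (Fin 3) (Fin 3) K) F
        = ((c : K)⁻¹ * (c : K)) •
            substPoly ((A⁻¹ : GL (Fin 3) K) : Matrix (Fin 3) (Fin 3) K) F := by
          rw [inv_mul_cancel₀ (Units.ne_zero c), one_smul]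
      _ = (c : K)⁻¹ • ((c : K) •
            substPoly ((A⁻¹ : GL (Fin 3) K) : Matrix (Fin 3) (Fin 3) K) F) := by
          rw [smul_smul]
      _ = (c : K)⁻¹ • F := by rw [key]
      _ = ((c⁻¹ : Kˣ) : K) • F := by rw [Units.val_inv_eq_inv_val]

/-- `PGL₃(K)`: the quotient of `GL₃(K)` by its center (the scalar matrices). -/
abbrev PGL3 (K : Type*) [Field K] := GL (Fin 3) K ⧸ Subgroup.center (GL (Fin 3) K)

/-- The automorphism group of the plane curve `F = 0`, as a subgroup of `PGL₃(K)`: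
the classes of matrices `A` with `F ∘ A = λ • F` for some `λ ∈ Kˣ`. -/
def projAut (F : MvPolynomial (Fin 3) K) : Subgroup (PGL3 K) :=
  (autGL F).map (QuotientGroup.mk' (Subgroup.center (GL (Fin 3) K)))

/-- `F` is nonsingular: the only common zero of its partial derivatives is the origin. -/
def IsNonsingular (F : MvPolynomial (Fin 3) K) : Prop :=
  ∀ x : Fin 3 → K, (∀ i, eval x (pderiv i F) = 0) → x = 0

/-- `F` and `G` are projectively equivalent: `F ∘ A = λ • G` for some `A ∈ GL₃(K)`, `λ ∈ Kˣ`. -/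
def ProjEquiv (F G : MvPolynomial (Fin 3) K) : Prop :=
  ∃ A : GL (Fin 3) K, ∃ c : Kˣ,
    substPoly (A : Matrix (Fin 3) (Fin 3) K) F = (c : K) • G


/-- Chain rule for linear substitutions. -/
lemma pderiv_substPoly (A : Matrix (Fin 3) (Fin 3) K) (F : MvPolynomial (Fin 3) K) (j : Fin 3) :
    pderiv j (substPoly A F) = ∑ i, A i j • substPoly A (pderiv i F) := by
  induction F using MvPolynomial.induction_on with
  | C a => simp [substPoly]
  | add p q hp hq =>
    have h1 : substPoly A (p + q) = substPoly A p + substPoly A q := by simp [substPoly]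
    have h2 : ∀ i, substPoly A (pderiv i (p + q))
        = substPoly A (pderiv i p) + substPoly A (pderiv i q) := by simp [substPoly]
    simp only [h2, smul_add, Finset.sum_add_distrib]
    rw [h1, map_add, hp, hq]
  | mul_X p k hp =>
    have h1 : substPoly A (p * X k) = substPoly A p * substPoly A (X k) := by simp [substPoly]
    have h2 : ∀ i, substPoly A (pderiv i (p * X k))
        = substPoly A (pderiv i p) * substPoly A (X k)
          + substPoly A p * substPoly A (pderiv i (X k)) := by
      intro i; simp [substPoly, pderiv_mul, mul_comm, -pderiv_X]; ring
    have h3 : pderiv j (substPoly A (X k)) = ∑ i, A i j • substPoly A (pderiv i (X k)) := by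
      fin_cases j <;> fin_cases k <;>
        simp [substPoly, pderiv_X, Fin.sum_univ_three, Pi.single_apply, smul_eq_C_mul]
    simp only [h2, smul_add, Finset.sum_add_distrib]
    rw [h1, pderiv_mul, hp, h3]
    simp only [Finset.sum_mul, Finset.mul_sum, smul_mul_assoc, mul_smul_comm]

lemma eval_substPoly (A : Matrix (Fin 3) (Fin 3) K) (F : MvPolynomial (Fin 3) K)
    (x : Fin 3 → K) : eval x (substPoly A F) = eval (A *ᵥ x) F := by
  induction F using MvPolynomial.induction_on with
  | C a => simp [substPoly]
  | add p q hp hq => 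
    have h1 : substPoly A (p + q) = substPoly A p + substPoly A q := by simp [substPoly]
    rw [h1, map_add, hp, hq, map_add]
  | mul_X p k hp =>
    have h1 : substPoly A (p * X k) = substPoly A p * substPoly A (X k) := by simp [substPoly]
    rw [h1, map_mul, hp, map_mul]
    congr 1
    simp [substPoly, Matrix.mulVec, dotProduct, smul_eval]

lemma eval_smul_hom {F : MvPolynomial (Fin 3) K} {n : ℕ} (h : F.IsHomogeneous n) (c : K)
    (x : Fin 3 → K) : eval (c • x) F = c ^ n * eval x F := by
  rw [eval_eq, eval_eq, Finset.mul_sum]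
  refine Finset.sum_congr rfl fun d hd => ?_
  have hd' := h (mem_support_iff.mp hd)
  rw [Finsupp.weight_apply, Finsupp.sum] at hd'
  simp only [Pi.one_apply, smul_eq_mul, mul_one] at hd'
  simp only [Pi.smul_apply, smul_eq_mul, mul_pow, Finset.prod_mul_distrib, Finset.prod_pow_eq_pow_sum,
    hd']
  ring

lemma exists_zero_on_line [IsAlgClosed K] {G : MvPolynomial (Fin 3) K} {n : ℕ} (hn : n ≠ 0)
    (h : G.IsHomogeneous n) (u v : Fin 3 → K) :
    ∃ s t : K, (s ≠ 0 ∨ t ≠ 0) ∧ eval (s • u + t • v) G = 0 := by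
  have hpoly : ∀ a b : Fin 3 → K, ∃ p : Polynomial K, ∀ t, p.eval t = eval (a + t • b) G := by
    intro a b
    refine ⟨aeval (fun i => Polynomial.C (a i) + Polynomial.X * Polynomial.C (b i)) G, fun t => ?_⟩
    rw [← Polynomial.coe_evalRingHom, aeval_def, eval₂_comp_left, eval]
    simp only [coe_eval₂Hom]
    congr 1
    · ext; simp
    · ext i; simp; exact mul_comm _ _
  obtain ⟨p, hp⟩ := hpoly u v
  by_cases hd : p.degree = 0
  · obtain ⟨r, hr⟩ := hpoly v u
    rw [Polynomial.eq_C_of_degree_eq_zero hd] at hp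
    set a := p.coeff 0
    simp only [Polynomial.eval_C] at hp
    have key : r = Polynomial.C a * Polynomial.X ^ n := by
      refine Polynomial.eq_of_infinite_eval_eq _ _ ?_
      refine Set.Infinite.mono (s := {0}ᶜ) ?_ (Set.finite_singleton (0 : K)).infinite_compl
      intro s hs
      have hs : s ≠ 0 := hs
      have : v + s • u = s • (u + s⁻¹ • v) := by
        rw [smul_add, smul_smul, mul_inv_cancel₀ hs, one_smul, add_comm]
      simp only [Set.mem_ofPred_eq, hr, this, eval_smul_hom h, ← hp, Polynomial.eval_mul,
        Polynomial.eval_C, Polynomial.eval_pow, Polynomial.eval_X]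
      ring
    refine ⟨0, 1, Or.inr one_ne_zero, ?_⟩
    have := hr 0
    rw [key] at this
    simp [hn] at this
    simpa using this.symm
  · obtain ⟨t, ht⟩ := IsAlgClosed.exists_root p hd
    refine ⟨1, t, Or.inl one_ne_zero, ?_⟩
    rw [one_smul, ← hp]; exact ht

lemma adjugate_three (A : Matrix (Fin 3) (Fin 3) K) :
    A * A - A.trace • A + A.adjugate.trace • (1 : Matrix (Fin 3) (Fin 3) K) = A.adjugate := by
  ext i j
  fin_cases i <;> fin_cases j <;>
    simp [adjugate_fin_three, Matrix.mul_apply, Matrix.trace, Fin.sum_univ_three] <;> ring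

lemma trace_of_involution {g : Matrix (Fin 3) (Fin 3) K} (h2 : g * g = 1) (hdet : g.det = 1)
    (h1 : g ≠ 1) : g.trace = -1 := by
  have hadj : g.adjugate = g := by
    calc g.adjugate = g * (g * g.adjugate) := by rw [← mul_assoc, h2, one_mul]
      _ = g := by rw [mul_adjugate, hdet, one_smul, mul_one]
  have h := adjugate_three g
  rw [hadj, h2] at h
  have h' : (g.trace + 1) • (1 - g) = 0 := by
    have : (g.trace + 1) • (1 - g) = (1 - g.trace • g + g.trace • 1) - g := by
      rw [smul_sub, add_smul, add_smul, one_smul, one_smul]; abel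
    rw [this, h, sub_self]
  rcases smul_eq_zero.mp h' with h | h
  · exact eq_neg_of_add_eq_zero_left h
  · exact absurd (sub_eq_zero.mp h).symm h1

lemma involution_basis [CharZero K] {g : Matrix (Fin 3) (Fin 3) K} (h2 : g * g = 1)
    (hdet : g.det = 1) (h1 : g ≠ 1) :
    ∃ u v w : Fin 3 → K, LinearIndependent K ![u, v] ∧ g *ᵥ u = -u ∧ g *ᵥ v = -v ∧
      ∀ y : Fin 3 → K, ∃ (c : K) (z : Fin 3 → K), g *ᵥ z = -z ∧ y = c • w + z := by
  have htr := trace_of_involution h2 hdet h1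
  set Q : Matrix (Fin 3) (Fin 3) K := (2⁻¹ : K) • (1 + g) with hQ
  have hQQ : Q * Q = Q := by
    have : (1 + g) * (1 + g) = (2 : K) • (1 + g) := by
      rw [mul_add, add_mul, add_mul, h2, two_smul]; simp; abel
    rw [hQ, smul_mul_smul_comm, this, smul_smul]; congr 1; norm_num
  set P := Matrix.toLin' Q with hP
  have hPP : ∀ x, P (P x) = P x := by
    intro x; simp only [hP, Matrix.toLin'_apply, Matrix.mulVec_mulVec, hQQ]
  have hproj : LinearMap.IsProj (LinearMap.range P) P :=
    ⟨fun x => ⟨x, rfl⟩, by rintro _ ⟨x, rfl⟩; exact hPP x⟩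
  have hrk : Module.finrank K (LinearMap.range P) = 1 := by
    have := hproj.trace
    rw [hP, Matrix.trace_toLin'_eq, hQ, Matrix.trace_smul, Matrix.trace_add, htr] at this
    have h3 : (Module.finrank K (LinearMap.range P) : K) = ((1 : ℕ) : K) := by
      rw [hP, hQ, ← this]; simp; norm_num
    exact_mod_cast h3
  have hker : Module.finrank K (LinearMap.ker P) = 2 := by
    have := LinearMap.finrank_range_add_finrank_ker P
    simp at this; omega
  have hkerg : ∀ z ∈ LinearMap.ker P, g *ᵥ z = -z := by
    intro z hz
    rw [LinearMap.mem_ker, hP, Matrix.toLin'_apply, hQ, Matrix.smul_mulVec, Matrix.add_mulVec,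
      Matrix.one_mulVec] at hz
    have := (smul_eq_zero.mp hz).resolve_left (by norm_num)
    exact eq_neg_of_add_eq_zero_right this
  let b := Module.finBasisOfFinrankEq K _ hker
  obtain ⟨w, -, hw⟩ := finrank_eq_one_iff'.mp hrk
  refine ⟨b 0, b 1, w, ?_, hkerg _ (b 0).2, hkerg _ (b 1).2, fun y => ?_⟩
  · have := b.linearIndependent.map' (LinearMap.ker P).subtype (Submodule.ker_subtype _)
    have hfun : ((LinearMap.ker P).subtype ∘ b : Fin 2 → Fin 3 → K) = ![↑(b 0), ↑(b 1)] := by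
      funext i; fin_cases i <;> rfl
    rw [← hfun]
    exact this
  · obtain ⟨c, hc⟩ := hw ⟨P y, y, rfl⟩
    refine ⟨c, y - P y, hkerg _ ?_, ?_⟩
    · rw [LinearMap.mem_ker, map_sub, hPP, sub_self]
    · have := congrArg Subtype.val hc
      simp at this
      rw [this]; abel

lemma no_det_one_involution [IsAlgClosed K] [CharZero K] {F : MvPolynomial (Fin 3) K}
    (hhom : F.IsHomogeneous 5) (hns : IsNonsingular F) {g : Matrix (Fin 3) (Fin 3) K}
    (h2 : g * g = 1) (hdet : g.det = 1) (hF : substPoly g F = F) : g = 1 := by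
  by_contra h1
  obtain ⟨u, v, w, hli, hu, hv, hspan⟩ := involution_basis h2 hdet h1
  have hpd : ∀ i, (pderiv i F).IsHomogeneous 4 := fun i => hhom.pderiv
  have hG : (∑ i, C (w i) * pderiv i F).IsHomogeneous 4 := by
    refine IsHomogeneous.sum _ _ _ fun i _ => ?_
    simpa using (isHomogeneous_C (Fin 3) (w i)).mul (hpd i)
  obtain ⟨s, t, hst, h0⟩ := exists_zero_on_line (by norm_num) hG u v
  set x := s • u + t • v with hx
  have hgx : g *ᵥ x = -x := by
    rw [hx, mulVec_add, mulVec_smul, mulVec_smul, hu, hv]; simp; abel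
  set c : Fin 3 → K := fun i => eval x (pderiv i F) with hc
  have hcg : c ᵥ* g = c := by
    ext j
    have := congrArg (eval x) (pderiv_substPoly g F j)
    rw [hF, map_sum] at this
    simp only [hc]
    rw [this]
    simp only [vecMul, dotProduct, smul_eval, eval_substPoly, hgx]
    refine Finset.sum_congr rfl fun i _ => ?_
    have h := eval_smul_hom (hpd i) (-1) x
    rw [neg_one_smul] at h
    rw [h]; ring
  have hz : ∀ z, g *ᵥ z = -z → c ⬝ᵥ z = 0 := by
    intro z hz
    have h : c ⬝ᵥ z = - (c ⬝ᵥ z) := by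
      conv_lhs => rw [← hcg, ← dotProduct_mulVec, hz, dotProduct_neg]
    exact self_eq_neg.mp h
  have hw : c ⬝ᵥ w = 0 := by
    rw [← h0, map_sum]
    simp [dotProduct, hc, mul_comm]
  have hc0 : ∀ y, c ⬝ᵥ y = 0 := by
    intro y
    obtain ⟨a, z, hz', rfl⟩ := hspan y
    rw [dotProduct_add, dotProduct_smul, hw, hz z hz']; simp
  have hc00 : c = 0 := dotProduct_eq_zero _ hc0
  have hx0 := hns x fun i => congrFun hc00 i
  have := LinearIndependent.pair_iff.mp hli s t hx0
  rcases hst with h | h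
  · exact h this.1
  · exact h this.2

lemma substPoly_smul_hom {F : MvPolynomial (Fin 3) K} {n : ℕ} [Infinite K]
    (h : F.IsHomogeneous n) (c : K) (A : Matrix (Fin 3) (Fin 3) K) :
    substPoly (c • A) F = c ^ n • substPoly A F := by
  refine MvPolynomial.funext fun x => ?_
  rw [eval_substPoly, Matrix.smul_mulVec, eval_smul_hom h, smul_eval, eval_substPoly]

lemma exists_lift [IsAlgClosed K] [CharZero K] {F : MvPolynomial (Fin 3) K}
    (hhom : F.IsHomogeneous 5) (hF0 : F ≠ 0) {a : PGL3 K} (ha : a ∈ projAut F) (haa : a * a = 1) :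
    ∃ A : GL (Fin 3) K, (QuotientGroup.mk A : PGL3 K) = a ∧
      (A : Matrix (Fin 3) (Fin 3) K) * (A : Matrix (Fin 3) (Fin 3) K) = 1 ∧
      substPoly (A : Matrix (Fin 3) (Fin 3) K) F = F := by
  obtain ⟨A, ⟨l, hl⟩, rfl⟩ := ha
  have hc : A * A ∈ Subgroup.center (GL (Fin 3) K) := by
    rw [← QuotientGroup.eq_one_iff]; exact haa
  rw [GeneralLinearGroup.mem_center_iff_val_mem_range_scalar] at hc
  obtain ⟨m, hm⟩ := hc
  have hm' : (A : Matrix (Fin 3) (Fin 3) K) * (A : Matrix (Fin 3) (Fin 3) K)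
      = m • (1 : Matrix (Fin 3) (Fin 3) K) := by
    rw [← Units.val_mul, ← hm, smul_one_eq_diagonal]; rfl
  have hm0 : m ≠ 0 := by
    rintro rfl
    rw [zero_smul, ← Units.val_mul] at hm'
    exact (A * A).ne_zero hm'
  obtain ⟨n, hn⟩ := IsAlgClosed.exists_pow_nat_eq m (n := 2) (by norm_num)
  have hn0 : n ≠ 0 := by rintro rfl; apply hm0; rw [← hn]; norm_num
  -- scaled matrices give the same class
  have scale : ∀ c : K, c ≠ 0 → ∃ B : GL (Fin 3) K,
      (QuotientGroup.mk B : PGL3 K) = QuotientGroup.mk A ∧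
      (B : Matrix (Fin 3) (Fin 3) K) = c • (A : Matrix (Fin 3) (Fin 3) K) := by
    intro c hc0
    let z : GL (Fin 3) K := GeneralLinearGroup.scalar (Fin 3) (Units.mk0 c hc0)
    have hzv : (z : Matrix (Fin 3) (Fin 3) K) = c • 1 := by
      rw [smul_one_eq_diagonal]; rfl
    refine ⟨A * z, ?_, ?_⟩
    · rw [eq_comm, QuotientGroup.eq, inv_mul_cancel_left,
        GeneralLinearGroup.mem_center_iff_val_mem_range_scalar]
      exact ⟨c, rfl⟩
    · rw [Units.val_mul, hzv]; simp
  set e : K := n⁻¹ ^ 5 * l with he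
  have hsq : ∀ c : K, c ^ 2 = m⁻¹ → (c • (A : Matrix (Fin 3) (Fin 3) K)) *
      (c • (A : Matrix (Fin 3) (Fin 3) K)) = 1 := by
    intro c hc
    rw [smul_mul_smul_comm, hm', smul_smul, ← pow_two, hc, inv_mul_cancel₀ hm0, one_smul]
  have hsub : ∀ c : K, substPoly (c • (A : Matrix (Fin 3) (Fin 3) K)) F = (c ^ 5 * l) • F := by
    intro c
    rw [substPoly_smul_hom hhom, hl, smul_smul]
  have hn2 : n⁻¹ ^ 2 = m⁻¹ := by rw [inv_pow, hn]
  have he2 : e = 1 ∨ e = -1 := by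
    have h := substPoly_mul (n⁻¹ • (A : Matrix (Fin 3) (Fin 3) K)) (n⁻¹ • A.val) F
    rw [hsq _ hn2, substPoly_one, hsub, substPoly_smul, hsub, smul_smul] at h
    have : (e * e - 1) • F = 0 := by rw [sub_smul, one_smul, he, ← h, sub_self]
    have := (smul_eq_zero.mp this).resolve_right hF0
    exact mul_self_eq_one_iff.mp (sub_eq_zero.mp this)
  rcases he2 with h | h
  · obtain ⟨B, hB, hBA⟩ := scale n⁻¹ (inv_ne_zero hn0)
    refine ⟨B, hB, ?_, ?_⟩
    · rw [hBA, hsq _ hn2]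
    · rw [hBA, hsub, ← he, h, one_smul]
  · obtain ⟨B, hB, hBA⟩ := scale (-n⁻¹) (neg_ne_zero.mpr (inv_ne_zero hn0))
    refine ⟨B, hB, ?_, ?_⟩
    · rw [hBA, hsq _ (by rw [neg_sq, hn2])]
    · have : (-n⁻¹) ^ 5 * (l : K) = 1 := by
        have : (-n⁻¹) ^ 5 * (l : K) = - e := by rw [he]; ring
        rw [this, h, neg_neg]
      rw [hBA, hsub, this, one_smul]

lemma no_klein [IsAlgClosed K] [CharZero K] {F : MvPolynomial (Fin 3) K}
    (hhom : F.IsHomogeneous 5) (hns : IsNonsingular F) {a b : PGL3 K}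
    (ha : a ∈ projAut F) (hb : b ∈ projAut F) (ha2 : a * a = 1) (hb2 : b * b = 1)
    (hab2 : (a * b) * (a * b) = 1) (ha1 : a ≠ 1) (hb1 : b ≠ 1) (hab1 : a * b ≠ 1) : False := by
  have hF0 : F ≠ 0 := by
    rintro rfl
    have := hns 1 (by simp)
    exact one_ne_zero this
  have hdet : ∀ A : GL (Fin 3) K, (QuotientGroup.mk A : PGL3 K) ≠ 1 →
      (A : Matrix (Fin 3) (Fin 3) K) * (A : Matrix (Fin 3) (Fin 3) K) = 1 →
      substPoly (A : Matrix (Fin 3) (Fin 3) K) F = F →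
      (A : Matrix (Fin 3) (Fin 3) K).det = -1 := by
    intro A hA1 hAA hAF
    have h := congrArg Matrix.det hAA
    rw [det_mul, det_one] at h
    refine (mul_self_eq_one_iff.mp h).resolve_left fun h' => hA1 ?_
    have : A = 1 := Units.ext (no_det_one_involution hhom hns hAA h' hAF)
    rw [this]; rfl
  obtain ⟨A, rfl, hAA, hAF⟩ := exists_lift hhom hF0 ha ha2
  obtain ⟨B, rfl, hBB, hBF⟩ := exists_lift hhom hF0 hb hb2
  obtain ⟨D, hD, hDD, hDF⟩ := exists_lift hhom hF0 (mul_mem ha hb) hab2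
  have dA := hdet A ha1 hAA hAF
  have dB := hdet B hb1 hBB hBF
  have dD := hdet D (hD ▸ hab1) hDD hDF
  have hD' : (QuotientGroup.mk (A * B) : PGL3 K) = QuotientGroup.mk D := hD.symm
  rw [QuotientGroup.eq, GeneralLinearGroup.mem_center_iff_val_mem_range_scalar] at hD'
  obtain ⟨d, hd⟩ := hD'
  have hDv : (D : Matrix (Fin 3) (Fin 3) K) = d • (A.val * B.val) := by
    have h : D = (A * B) * ((A * B)⁻¹ * D) := by group
    have h3 : (((A * B)⁻¹ * D : GL (Fin 3) K) : Matrix (Fin 3) (Fin 3) K)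
        = d • (1 : Matrix (Fin 3) (Fin 3) K) := by
      rw [← hd, smul_one_eq_diagonal]; rfl
    rw [h, Units.val_mul, h3, Units.val_mul]; simp
  have hd5 : d ^ 5 = 1 := by
    have h := hDF
    rw [hDv, substPoly_smul_hom hhom, substPoly_mul, hAF, hBF] at h
    have : (d ^ 5 - 1) • F = 0 := by rw [sub_smul, one_smul, h, sub_self]
    exact sub_eq_zero.mp ((smul_eq_zero.mp this).resolve_right hF0)
  have hd3 : d ^ 3 = -1 := by
    rw [hDv, det_smul, det_mul, dA, dB] at dD
    simpa using dD
  have h1 : d = 1 := by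
    have h6 : d ^ 6 = 1 := by linear_combination (d ^ 3 - 1) * hd3
    linear_combination h6 - d * hd5
  rw [h1] at hd3
  norm_num at hd3

lemma no_klein_hom [IsAlgClosed K] [CharZero K] {F : MvPolynomial (Fin 3) K}
    (hhom : F.IsHomogeneous 5) (hns : IsNonsingular F) {H : Subgroup (PGL3 K)}
    (hH : H ≤ projAut F) {G : Type*} [Group G] (e : ↥H ≃* G) (a b : G)
    (ha2 : a * a = 1) (hb2 : b * b = 1)
    (hab2 : (a * b) * (a * b) = 1) (ha1 : a ≠ 1) (hb1 : b ≠ 1) (hab1 : a * b ≠ 1) : False := by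
  let f : G →* PGL3 K := H.subtype.comp e.symm.toMonoidHom
  have hf : Function.Injective f := H.subtype_injective.comp e.symm.injective
  have hm : ∀ x, f x ∈ projAut F := fun x => hH (e.symm x).2
  have h1 : ∀ x, x ≠ 1 → f x ≠ 1 := fun x hx h => hx (hf (h.trans f.map_one.symm))
  refine no_klein hhom hns (hm a) (hm b) ?_ ?_ ?_ (h1 a ha1) (h1 b hb1) ?_
  · rw [← map_mul, ha2, map_one]
  · rw [← map_mul, hb2, map_one]
  · rw [← map_mul, ← map_mul, hab2, map_one]
  · rw [← map_mul]; exact h1 _ hab1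

/-- the automorphism group of a nonsingular plane quintic contains no
Klein four subgroup; in particular none of `ℤ/2 × ℤ/2`, `A₄`, `S₄`, `A₅` occurs as the
automorphism group of a nonsingular plane curve of degree 5. -/
theorem stmt16 {K : Type*} [Field K] [IsAlgClosed K] [CharZero K]
    (F : MvPolynomial (Fin 3) K)
    (hhom : F.IsHomogeneous 5) (hns : IsNonsingular F) :
    (¬ ∃ H : Subgroup (PGL3 K), H ≤ projAut F ∧
      Nonempty (↥H ≃* Multiplicative (ZMod 2 × ZMod 2))) ∧
    ¬ Nonempty (↥(projAut F) ≃* Multiplicative (ZMod 2 × ZMod 2)) ∧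
    ¬ Nonempty (↥(projAut F) ≃* alternatingGroup (Fin 4)) ∧
    ¬ Nonempty (↥(projAut F) ≃* Equiv.Perm (Fin 4)) ∧
    ¬ Nonempty (↥(projAut F) ≃* alternatingGroup (Fin 5)) := by
  have key : ¬ ∃ H : Subgroup (PGL3 K), H ≤ projAut F ∧
      Nonempty (↥H ≃* Multiplicative (ZMod 2 × ZMod 2)) := by
    rintro ⟨H, hH, ⟨e⟩⟩
    exact no_klein_hom hhom hns hH e (Multiplicative.ofAdd (1, 0)) (Multiplicative.ofAdd (0, 1))
      (by decide) (by decide) (by decide) (by decide) (by decide) (by decide)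
  refine ⟨key, fun h => key ⟨_, le_rfl, h⟩, ?_, ?_, ?_⟩
  · rintro ⟨e⟩
    exact no_klein_hom hhom hns le_rfl e
      ⟨Equiv.swap 0 1 * Equiv.swap 2 3, Equiv.Perm.mem_alternatingGroup.mpr (by decide)⟩
      ⟨Equiv.swap 0 2 * Equiv.swap 1 3, Equiv.Perm.mem_alternatingGroup.mpr (by decide)⟩
      (by decide) (by decide) (by decide) (by decide) (by decide) (by decide)
  · rintro ⟨e⟩
    exact no_klein_hom hhom hns le_rfl e
      (Equiv.swap 0 1) (Equiv.swap 2 3)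
      (by decide) (by decide) (by decide) (by decide) (by decide) (by decide)
  · rintro ⟨e⟩
    exact no_klein_hom hhom hns le_rfl e
      ⟨Equiv.swap 0 1 * Equiv.swap 2 3, Equiv.Perm.mem_alternatingGroup.mpr (by decide)⟩
      ⟨Equiv.swap 0 2 * Equiv.swap 1 3, Equiv.Perm.mem_alternatingGroup.mpr (by decide)⟩
      (by decide) (by decide) (by decide) (by decide) (by decide) (by decide)

end
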